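/- arXiv:1803.01792 — 5 statements merged into one kernel-verified Lean document; each statement's English description precedes it below -/
import Mathlib

section
/- Let X ⊆ ℝ^n and Y ⊆ ℝ^m be nonempty compact convex sets and let c : X × Y → ℝ be a biaffine function, i.e., c(αx + (1−α)x', y) = αc(x,y) + (1−α)c(x',y) and c(x, αy + (1−α)y') = αc(x,y) + (1−α)c(x,y') for every α ∈ [0,1], x, x' ∈ X and y, y' ∈ Y. Then min_{x∈X} max_{y∈Y} c(x,y) = max_{y∈Y} min_{x∈X} c(x,y) (all the indicated minima and maxima are attained). -/
/-- The submodule generated by the increments `(x - y, f x - f y)` of a function which is affine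
on a convex set `X`; convexity makes every element a multiple of a single increment. -/
def affineIncrements {E : Type*} [AddCommGroup E] [Module ℝ E] {X : Set E} {f : E → ℝ}
    (hne : X.Nonempty) (hX : Convex ℝ X)
    (hf : ∀ α ∈ Set.Icc (0 : ℝ) 1, ∀ x ∈ X, ∀ y ∈ X,
      f (α • x + (1 - α) • y) = α * f x + (1 - α) * f y) : Submodule ℝ (E × ℝ) where
  carrier := {p | ∃ a : ℝ, 0 ≤ a ∧ ∃ x ∈ X, ∃ y ∈ X, p = (a • (x - y), a * (f x - f y))}
  zero_mem' := by
    obtain ⟨x, hx⟩ := hne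
    exact ⟨0, le_rfl, x, hx, x, hx, by simp [Prod.zero_eq_mk]⟩
  add_mem' := by
    rintro _ _ ⟨a, ha, x, hx, y, hy, rfl⟩ ⟨b, hb, x', hx', y', hy', rfl⟩
    rcases (add_nonneg ha hb).eq_or_lt with h | h
    · obtain rfl : a = 0 := by linarith
      obtain rfl : b = 0 := by linarith
      exact ⟨0, le_rfl, x, hx, x, hx, by simp⟩
    have hα : a / (a + b) ∈ Set.Icc (0 : ℝ) 1 :=
      ⟨by positivity, (div_le_one h).2 (by linarith)⟩
    have h₁ : (a + b) * (a / (a + b)) = a := by field_simp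
    have h₂ : (a + b) * (1 - a / (a + b)) = b := by field_simp; ring
    refine ⟨a + b, h.le,
      _, hX hx hx' hα.1 (sub_nonneg.2 hα.2) (add_sub_cancel _ _),
      _, hX hy hy' hα.1 (sub_nonneg.2 hα.2) (add_sub_cancel _ _), ?_⟩
    rw [hf _ hα x hx x' hx', hf _ hα y hy y' hy']
    refine Prod.ext ?_ ?_
    · simp only [Prod.mk_add_mk, smul_sub, smul_add, smul_smul, h₁, h₂]
      abel
    · simp only [Prod.mk_add_mk]
      linear_combination (f y - f x) * h₁ + (f y' - f x') * h₂
  smul_mem' := by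
    rintro r _ ⟨a, ha, x, hx, y, hy, rfl⟩
    rcases le_total 0 r with hr | hr
    · exact ⟨r * a, mul_nonneg hr ha, x, hx, y, hy, by simp [smul_smul, mul_assoc]⟩
    · refine ⟨-r * a, mul_nonneg (neg_nonneg.2 hr) ha, y, hy, x, hx, Prod.ext ?_ ?_⟩
      · simp only [Prod.smul_mk]
        module
      · simp only [Prod.smul_mk, smul_eq_mul]
        ring

/-- A function which is affine on a convex set has linear increments there. -/
theorem exists_linearMap_sub_eq {E : Type*} [AddCommGroup E] [Module ℝ E] {X : Set E} {f : E → ℝ}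
    (hne : X.Nonempty) (hX : Convex ℝ X)
    (hf : ∀ α ∈ Set.Icc (0 : ℝ) 1, ∀ x ∈ X, ∀ y ∈ X,
      f (α • x + (1 - α) • y) = α * f x + (1 - α) * f y) :
    ∃ L : E →ₗ[ℝ] ℝ, ∀ x ∈ X, ∀ y ∈ X, L (x - y) = f x - f y := by
  set S := affineIncrements hne hX hf
  have hinj : LinearMap.ker ((LinearMap.fst ℝ E ℝ).comp S.subtype) = ⊥ := by
    rw [LinearMap.ker_eq_bot']
    rintro ⟨_, a, ha, x, hx, y, hy, rfl⟩ h
    have h : a • (x - y) = 0 := h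
    apply Subtype.ext
    rcases smul_eq_zero.1 h with rfl | h'
    · simp
    · simp [sub_eq_zero.1 h']
  obtain ⟨g, hg⟩ := LinearMap.exists_leftInverse_of_injective _ hinj
  refine ⟨(LinearMap.snd ℝ E ℝ).comp (S.subtype.comp g), fun x hx y hy => ?_⟩
  have h := LinearMap.congr_fun hg
    (⟨(x - y, f x - f y), 1, zero_le_one, x, hx, y, hy, by simp⟩ : S)
  exact congrArg (fun p : S => p.1.2) h

/-- A function which is affine on a convex set in a finite-dimensional space is continuous there. -/
theorem continuousOn_of_affine_on {E : Type*} [AddCommGroup E] [Module ℝ E] [TopologicalSpace E]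
    [IsTopologicalAddGroup E] [ContinuousSMul ℝ E] [T2Space E] [FiniteDimensional ℝ E]
    {X : Set E} {f : E → ℝ} (hX : Convex ℝ X)
    (hf : ∀ α ∈ Set.Icc (0 : ℝ) 1, ∀ x ∈ X, ∀ y ∈ X,
      f (α • x + (1 - α) • y) = α * f x + (1 - α) * f y) : ContinuousOn f X := by
  rcases X.eq_empty_or_nonempty with rfl | ⟨x₀, hx₀⟩
  · exact continuousOn_empty f
  obtain ⟨L, hL⟩ := exists_linearMap_sub_eq ⟨x₀, hx₀⟩ hX hf
  have hLc : Continuous L := L.continuous_of_finiteDimensional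
  have : Continuous fun x => L (x - x₀) + f x₀ := by fun_prop
  refine this.continuousOn.congr fun x hx => ?_
  simp [hL x hx x₀ hx₀]

theorem convexOn_of_affine_on {E : Type*} [AddCommGroup E] [Module ℝ E]
    {X : Set E} {f : E → ℝ} (hX : Convex ℝ X)
    (hf : ∀ α ∈ Set.Icc (0 : ℝ) 1, ∀ x ∈ X, ∀ y ∈ X,
      f (α • x + (1 - α) • y) = α * f x + (1 - α) * f y) : ConvexOn ℝ X f := by
  refine ⟨hX, fun x hx y hy a b ha hb hab => ?_⟩
  obtain rfl : b = 1 - a := by linarith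
  exact (hf a ⟨ha, by linarith⟩ x hx y hy).le

theorem concaveOn_of_affine_on {E : Type*} [AddCommGroup E] [Module ℝ E]
    {X : Set E} {f : E → ℝ} (hX : Convex ℝ X)
    (hf : ∀ α ∈ Set.Icc (0 : ℝ) 1, ∀ x ∈ X, ∀ y ∈ X,
      f (α • x + (1 - α) • y) = α * f x + (1 - α) * f y) : ConcaveOn ℝ X f := by
  refine ⟨hX, fun x hx y hy a b ha hb hab => ?_⟩
  obtain rfl : b = 1 - a := by linarith
  exact (hf a ⟨ha, by linarith⟩ x hx y hy).ge


/-- Minimax theorem for biaffine functions on nonempty compact convex sets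
`X ⊆ ℝ^n`, `Y ⊆ ℝ^m`: all indicated extrema are attained and
`min_{x∈X} max_{y∈Y} c(x,y) = max_{y∈Y} min_{x∈X} c(x,y)`. -/
theorem stmt_0 {n m : ℕ} (X : Set (Fin n → ℝ)) (Y : Set (Fin m → ℝ))
    (hXne : X.Nonempty) (hXcomp : IsCompact X) (hXconv : Convex ℝ X)
    (hYne : Y.Nonempty) (hYcomp : IsCompact Y) (hYconv : Convex ℝ Y)
    (c : (Fin n → ℝ) → (Fin m → ℝ) → ℝ)
    (hbx : ∀ α ∈ Set.Icc (0:ℝ) 1, ∀ x ∈ X, ∀ x' ∈ X, ∀ y ∈ Y,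
      c (α • x + (1 - α) • x') y = α * c x y + (1 - α) * c x' y)
    (hby : ∀ α ∈ Set.Icc (0:ℝ) 1, ∀ x ∈ X, ∀ y ∈ Y, ∀ y' ∈ Y,
      c x (α • y + (1 - α) • y') = α * c x y + (1 - α) * c x y') :
    -- the inner maxima and minima are attained
    (∀ x ∈ X, ∃ y₀ ∈ Y, c x y₀ = sSup ((fun y => c x y) '' Y)) ∧
    (∀ y ∈ Y, ∃ x₀ ∈ X, c x₀ y = sInf ((fun x => c x y) '' X)) ∧
    -- the outer minimum and maximum are attained
    (∃ x₀ ∈ X, sSup ((fun y => c x₀ y) '' Y)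
        = sInf ((fun x => sSup ((fun y => c x y) '' Y)) '' X)) ∧
    (∃ y₀ ∈ Y, sInf ((fun x => c x y₀) '' X)
        = sSup ((fun y => sInf ((fun x => c x y) '' X)) '' Y)) ∧
    -- min max = max min
    sInf ((fun x => sSup ((fun y => c x y) '' Y)) '' X)
      = sSup ((fun y => sInf ((fun x => c x y) '' X)) '' Y) := by
  have hfx : ∀ y ∈ Y, ∀ α ∈ Set.Icc (0 : ℝ) 1, ∀ x ∈ X, ∀ x' ∈ X,
      c (α • x + (1 - α) • x') y = α * c x y + (1 - α) * c x' y :=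
    fun y hy α hα x hx x' hx' => hbx α hα x hx x' hx' y hy
  have hfy : ∀ x ∈ X, ∀ α ∈ Set.Icc (0 : ℝ) 1, ∀ y ∈ Y, ∀ y' ∈ Y,
      c x (α • y + (1 - α) • y') = α * c x y + (1 - α) * c x y' :=
    fun x hx α hα => hby α hα x hx
  have hcx : ∀ y ∈ Y, ContinuousOn (fun x => c x y) X :=
    fun y hy => continuousOn_of_affine_on hXconv (hfx y hy)
  have hcy : ∀ x ∈ X, ContinuousOn (fun y => c x y) Y :=
    fun x hx => continuousOn_of_affine_on hYconv (hfy x hx)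
  obtain ⟨a, ha, b, hb, hab⟩ := Sion.exists_isSaddlePointOn (f := c) hXne hXconv hXcomp
    (fun y hy => (hcx y hy).lowerSemicontinuousOn)
    (fun y hy => (convexOn_of_affine_on hXconv (hfx y hy)).quasiconvexOn)
    hYconv hYne hYcomp
    (fun x hx => (hcy x hx).upperSemicontinuousOn)
    (fun x hx => (concaveOn_of_affine_on hYconv (hfy x hx)).quasiconcaveOn)
  have hsup : sSup ((fun y => c a y) '' Y) = c a b :=
    IsGreatest.csSup_eq ⟨⟨b, hb, rfl⟩, Set.forall_mem_image.2 fun y hy => hab a ha y hy⟩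
  have hinf : sInf ((fun x => c x b) '' X) = c a b :=
    IsLeast.csInf_eq ⟨⟨a, ha, rfl⟩, Set.forall_mem_image.2 fun x hx => hab x hx b hb⟩
  have hminmax : sInf ((fun x => sSup ((fun y => c x y) '' Y)) '' X) = c a b :=
    IsLeast.csInf_eq ⟨⟨a, ha, hsup⟩, Set.forall_mem_image.2 fun x hx =>
      (hab x hx b hb).trans
        (le_csSup (hYcomp.image_of_continuousOn (hcy x hx)).bddAbove ⟨b, hb, rfl⟩)⟩
  have hmaxmin : sSup ((fun y => sInf ((fun x => c x y) '' X)) '' Y) = c a b :=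
    IsGreatest.csSup_eq ⟨⟨b, hb, hinf⟩, Set.forall_mem_image.2 fun y hy =>
      (csInf_le (hXcomp.image_of_continuousOn (hcx y hy)).bddBelow ⟨a, ha, rfl⟩).trans
        (hab a ha y hy)⟩
  refine ⟨fun x hx => ?_, fun y hy => ?_, ⟨a, ha, hsup.trans hminmax.symm⟩,
    ⟨b, hb, hinf.trans hmaxmin.symm⟩, hminmax.trans hmaxmin.symm⟩
  · exact (hYcomp.image_of_continuousOn (hcy x hx)).sSup_mem (hYne.image _)
  · exact (hXcomp.image_of_continuousOn (hcx y hy)).sInf_mem (hXne.image _)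
end

section
/- Let M ∈ ℝ^{n×m}, let X ⊆ ℝ^n and Y ⊆ ℝ^m be nonempty compact convex sets, and let T ≥ 1. Suppose there exist plays x_1,…,x_T ∈ X and y_1,…,y_T ∈ Y such that Σ_{t=1}^T x_t^T M y_t ≤ min_{x∈X} Σ_{t=1}^T x^T M y_t + R_X and Σ_{t=1}^T x_t^T M y_t ≥ max_{y∈Y} Σ_{t=1}^T x_t^T M y − R_Y for some R_X, R_Y ≥ 0. Then min_{x∈X} max_{y∈Y} x^T M y ≤ max_{y∈Y} min_{x∈X} x^T M y + (R_X + R_Y)/T. -/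
open Matrix

/-- The uniform average of finitely many points of a convex set lies in the set. -/
lemma Convex.uniform_average_mem {E : Type*} [AddCommGroup E] [Module ℝ E] {s : Set E}
    (hs : Convex ℝ s) {T : ℕ} (hT : 1 ≤ T) {z : Fin T → E} (hz : ∀ t, z t ∈ s) :
    ((T : ℝ)⁻¹ • ∑ t, z t) ∈ s := by
  have hT0 : (T : ℝ) ≠ 0 := by positivity
  rw [Finset.smul_sum]
  exact hs.sum_mem (fun _ _ => by positivity) (by simp [hT0]) fun t _ => hz t

/-- A bilinear cost is bounded in absolute value on a product of compact sets. -/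
lemma exists_abs_dotProduct_mulVec_le {n m : ℕ} (M : Matrix (Fin n) (Fin m) ℝ)
    {X : Set (Fin n → ℝ)} {Y : Set (Fin m → ℝ)} (hX : IsCompact X) (hY : IsCompact Y) :
    ∃ B : ℝ, ∀ x ∈ X, ∀ y ∈ Y, |x ⬝ᵥ (M.mulVec y)| ≤ B := by
  have hc : Continuous fun p : (Fin n → ℝ) × (Fin m → ℝ) => p.1 ⬝ᵥ (M.mulVec p.2) := by
    fun_prop
  obtain ⟨B, hB⟩ := (hX.prod hY).exists_bound_of_continuousOn hc.continuousOn
  exact ⟨B, fun x hx y hy => hB (x, y) ⟨hx, hy⟩⟩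

/-- If both players' plays in a zero-sum matrix game satisfy regret bounds `R_X` and
`R_Y`, then `min_{x∈X} max_{y∈Y} xᵀMy ≤ max_{y∈Y} min_{x∈X} xᵀMy + (R_X + R_Y)/T`. -/
theorem stmt_3 {n m : ℕ} (M : Matrix (Fin n) (Fin m) ℝ)
    (X : Set (Fin n → ℝ)) (Y : Set (Fin m → ℝ))
    (hXne : X.Nonempty) (hXcomp : IsCompact X) (hXconv : Convex ℝ X)
    (hYne : Y.Nonempty) (hYcomp : IsCompact Y) (hYconv : Convex ℝ Y)
    (T : ℕ) (hT : 1 ≤ T) (RX RY : ℝ) (hRX : 0 ≤ RX) (hRY : 0 ≤ RY)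
    (hexists : ∃ (x : Fin T → (Fin n → ℝ)) (y : Fin T → (Fin m → ℝ)),
      (∀ t, x t ∈ X) ∧ (∀ t, y t ∈ Y) ∧
      (∑ t, (x t) ⬝ᵥ (M.mulVec (y t))
        ≤ sInf ((fun x' => ∑ t, x' ⬝ᵥ (M.mulVec (y t))) '' X) + RX) ∧
      (sSup ((fun y' => ∑ t, (x t) ⬝ᵥ (M.mulVec y')) '' Y) - RY
        ≤ ∑ t, (x t) ⬝ᵥ (M.mulVec (y t)))) :
    sInf ((fun x' => sSup ((fun y' => x' ⬝ᵥ (M.mulVec y')) '' Y)) '' X)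
      ≤ sSup ((fun y' => sInf ((fun x' => x' ⬝ᵥ (M.mulVec y')) '' X)) '' Y)
        + (RX + RY) / T := by
  obtain ⟨x, y, hx, hy, hRegX, hRegY⟩ := hexists
  obtain ⟨B, hB⟩ := exists_abs_dotProduct_mulVec_le M hXcomp hYcomp
  obtain ⟨x₀, hx₀⟩ := hXne
  obtain ⟨y₀, hy₀⟩ := hYne
  have hT0 : (0 : ℝ) < T := by positivity
  have hxbar := hXconv.uniform_average_mem hT hx
  have hybar := hYconv.uniform_average_mem hT hy
  set xbar := (T : ℝ)⁻¹ • ∑ t, x t with hxbar_def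
  set ybar := (T : ℝ)⁻¹ • ∑ t, y t with hybar_def
  set S := ∑ t, (x t) ⬝ᵥ (M.mulVec (y t))
  have hcx (y' : Fin m → ℝ) :
      xbar ⬝ᵥ (M.mulVec y') = (∑ t, (x t) ⬝ᵥ (M.mulVec y')) / T := by
    rw [hxbar_def, smul_dotProduct, sum_dotProduct, smul_eq_mul, inv_mul_eq_div]
  have hcy (x' : Fin n → ℝ) :
      x' ⬝ᵥ (M.mulVec ybar) = (∑ t, x' ⬝ᵥ (M.mulVec (y t))) / T := by
    rw [hybar_def, mulVec_smul, dotProduct_smul, mulVec_sum, dotProduct_sum, smul_eq_mul,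
      inv_mul_eq_div]
  have hupper : sInf ((fun x' => sSup ((fun y' => x' ⬝ᵥ (M.mulVec y')) '' Y)) '' X)
      ≤ (S + RY) / T := by
    refine (csInf_le ⟨-B, ?_⟩ (Set.mem_image_of_mem _ hxbar)).trans
      (csSup_le (Set.Nonempty.image _ ⟨y₀, hy₀⟩) ?_)
    · rintro _ ⟨x', hx', rfl⟩
      refine (abs_le.1 (hB x' hx' y₀ hy₀)).1.trans
        (le_csSup ⟨B, ?_⟩ (Set.mem_image_of_mem _ hy₀))
      rintro _ ⟨y', hy', rfl⟩
      exact (abs_le.1 (hB x' hx' y' hy')).2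
    · rintro _ ⟨y', hy', rfl⟩
      have hbdd : BddAbove ((fun y' => ∑ t, (x t) ⬝ᵥ (M.mulVec y')) '' Y) := by
        refine ⟨∑ _ : Fin T, B, ?_⟩
        rintro _ ⟨y', hy', rfl⟩
        exact Finset.sum_le_sum fun t _ => (abs_le.1 (hB _ (hx t) y' hy')).2
      have hle := le_csSup hbdd (Set.mem_image_of_mem _ hy')
      simp only [hcx]
      gcongr
      linarith
  have hlower : (S - RX) / T
      ≤ sSup ((fun y' => sInf ((fun x' => x' ⬝ᵥ (M.mulVec y')) '' X)) '' Y) := by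
    refine (le_csInf (Set.Nonempty.image _ ⟨x₀, hx₀⟩) ?_).trans
      (le_csSup ⟨B, ?_⟩ (Set.mem_image_of_mem _ hybar))
    · rintro _ ⟨x', hx', rfl⟩
      have hbdd : BddBelow ((fun x' => ∑ t, x' ⬝ᵥ (M.mulVec (y t))) '' X) := by
        refine ⟨∑ _ : Fin T, -B, ?_⟩
        rintro _ ⟨x', hx', rfl⟩
        exact Finset.sum_le_sum fun t _ => (abs_le.1 (hB x' hx' _ (hy t))).1
      have hle := csInf_le hbdd (Set.mem_image_of_mem _ hx')
      simp only [hcy]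
      gcongr
      linarith
    · rintro _ ⟨y', hy', rfl⟩
      refine (csInf_le ⟨-B, ?_⟩ (Set.mem_image_of_mem _ hx₀)).trans
        (abs_le.1 (hB x₀ hx₀ y' hy')).2
      rintro _ ⟨x', hx', rfl⟩
      exact (abs_le.1 (hB x' hx' y' hy')).1
  have hsplit : (S + RY) / T = (S - RX) / T + (RX + RY) / T := by ring
  linarith
end

section
/- Let K ⊆ ℝ^d be a nonempty compact convex set of (Euclidean) diameter at most D and let G > 0. There exists an online algorithm, i.e., a map A from finite sequences of loss vectors in ℝ^d to points of K, such that for every horizon T ≥ 1 and every sequence of loss vectors f^{(1)},…,f^{(T)} ∈ ℝ^d with ‖f^{(t)}‖₂ ≤ G for all t, the regret satisfies Σ_{t=1}^T ⟨f^{(t)}, A(f^{(1)},…,f^{(t−1)})⟩ − min_{x∈K} Σ_{t=1}^T ⟨f^{(t)}, x⟩ ≤ (3/2) G D √T; in particular the regret is o(T). -/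
open scoped RealInnerProductSpace

/-- A nonempty complete convex set admits a nearest-point map, characterised by its variational
inequality. -/
theorem exists_projection_inner_le_zero {E : Type*} [NormedAddCommGroup E]
    [InnerProductSpace ℝ E] {K : Set E} (hne : K.Nonempty) (hcomplete : IsComplete K)
    (hconv : Convex ℝ K) :
    ∃ P : E → E, ∀ u, P u ∈ K ∧ ∀ y ∈ K, ⟪u - P u, y - P u⟫ ≤ 0 := by
  choose P hPK hP using exists_norm_eq_iInf_of_complete_convex hne hcomplete hconv
  exact ⟨P, fun u => ⟨hPK u, (norm_eq_iInf_iff_real_inner_le_zero hconv (hPK u)).1 (hP u)⟩⟩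

/-- A point satisfying the variational inequality of the projection of `u` is at least as close as
`u` to `y`. -/
theorem norm_sub_sq_le_of_inner_le_zero {E : Type*} [NormedAddCommGroup E]
    [InnerProductSpace ℝ E] {u p y : E} (h : ⟪u - p, y - p⟫ ≤ 0) :
    ‖p - y‖ ^ 2 ≤ ‖u - y‖ ^ 2 := by
  have e : u - y = (u - p) - (y - p) := by abel
  rw [e, norm_sub_sq_real (u - p), norm_sub_rev p y]
  nlinarith [sq_nonneg ‖u - p‖]

/-- Online projected gradient descent on a list of loss vectors, the most recent one first, with
projection `P`, initial point `x₀` and step sizes `η`. -/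
noncomputable def projectedGradientDescent {E : Type*} [AddCommGroup E] [Module ℝ E] (P : E → E)
    (x₀ : E) (η : ℕ → ℝ) : List E → E
  | [] => x₀
  | v :: l => P (projectedGradientDescent P x₀ η l - η l.length • v)

/-- The regret bound of online gradient descent with step sizes `D / (G * √(t + 1))`, against a
fixed comparator `y`. -/
theorem sum_inner_sub_le_of_gradient_step {E : Type*} [NormedAddCommGroup E]
    [InnerProductSpace ℝ E] {D G : ℝ} (hD : 0 ≤ D) (hG : 0 < G) {T : ℕ} {f x : ℕ → E} {y : E}
    (hf : ∀ t < T, ‖f t‖ ≤ G) (hx : ∀ t, ‖x t - y‖ ≤ D)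
    (hstep : ∀ t, ‖x (t + 1) - y‖ ^ 2 ≤ ‖x t - (D / (G * √(t + 1 : ℝ))) • f t - y‖ ^ 2) :
    ∑ t ∈ Finset.range T, ⟪f t, x t - y⟫ ≤ (3 / 2) * G * D * √T := by
  rcases hD.eq_or_lt with rfl | hD
  · have h0 : ∀ t, x t - y = 0 := fun t => norm_le_zero_iff.1 (hx t)
    simp [h0]
  suffices h : ∀ n ≤ T, ∑ t ∈ Finset.range n, ⟪f t, x t - y⟫
      + ‖x n - y‖ ^ 2 * (G * √n / (2 * D)) ≤ (3 / 2) * G * D * √n by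
    have h1 := h T le_rfl
    have h2 : 0 ≤ ‖x T - y‖ ^ 2 * (G * √T / (2 * D)) := by positivity
    linarith
  intro n
  induction n with
  | zero => simp
  | succ n ih =>
    intro hn
    have ih := ih (by omega)
    rw [Finset.sum_range_succ]
    push_cast
    have hs := hstep n
    set s := √(n : ℝ)
    set r := √((n : ℝ) + 1)
    have hr : 0 < r := Real.sqrt_pos.2 (by positivity)
    have hs0 : 0 ≤ s := Real.sqrt_nonneg _
    have hsr : s ≤ r := Real.sqrt_le_sqrt (by linarith)
    have hr2 : r ^ 2 = n + 1 := Real.sq_sqrt (by positivity)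
    have hs2 : s ^ 2 = n := Real.sq_sqrt (by positivity)
    have hexpand : x n - (D / (G * r)) • f n - y = (x n - y) - (D / (G * r)) • f n := by abel
    rw [hexpand, norm_sub_sq_real (x n - y), inner_smul_right, norm_smul, mul_pow,
      Real.norm_eq_abs, sq_abs, real_inner_comm] at hs
    have hF : ‖f n‖ ^ 2 ≤ G ^ 2 := pow_le_pow_left₀ (norm_nonneg _) (hf n (by omega)) 2
    have ha : ‖x n - y‖ ^ 2 ≤ D ^ 2 := pow_le_pow_left₀ (norm_nonneg _) (hx n) 2
    generalize ⟪f n, x n - y⟫ = c at *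
    generalize ‖x n - y‖ ^ 2 = a at *
    generalize ‖x (n + 1) - y‖ ^ 2 = b at *
    have hs' : b ≤ a - 2 * (D / (G * r) * c) + (D / (G * r)) ^ 2 * G ^ 2 :=
      hs.trans (by gcongr)
    have hround : c + b * (G * r / (2 * D)) ≤ a * (G * r / (2 * D)) + G * D / (2 * r) := by
      have h := mul_le_mul_of_nonneg_right hs' (show 0 ≤ G * r / (2 * D) by positivity)
      have e : (a - 2 * (D / (G * r) * c) + (D / (G * r)) ^ 2 * G ^ 2) * (G * r / (2 * D))
          = a * (G * r / (2 * D)) - c + G * D / (2 * r) := by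
        field_simp
      linarith
    have hdiam : a * (G * r / (2 * D)) - a * (G * s / (2 * D)) ≤ G * D * (r - s) / 2 := by
      have h := mul_le_mul_of_nonneg_right ha
        (show 0 ≤ G * (r - s) / (2 * D) from
          div_nonneg (mul_nonneg hG.le (sub_nonneg.2 hsr)) (by positivity))
      have e : D ^ 2 * (G * (r - s) / (2 * D)) = G * D * (r - s) / 2 := by
        field_simp
      have e' : a * (G * (r - s) / (2 * D))
          = a * (G * r / (2 * D)) - a * (G * s / (2 * D)) := by ring
      linarith
    have hsqrt : G * D / (2 * r) ≤ G * D * (r - s) := by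
      rw [div_le_iff₀ (by positivity), mul_assoc]
      exact le_mul_of_one_le_right (by positivity) (by nlinarith)
    linarith

/-- Existence of a no-regret algorithm for online linear optimization over a nonempty
compact convex set `K ⊆ ℝ^d` of diameter at most `D`: for bounded loss vectors the
regret is at most `(3/2)·G·D·√T`, in particular `o(T)`. -/
theorem stmt_4 (d : ℕ) (K : Set (EuclideanSpace ℝ (Fin d)))
    (hKne : K.Nonempty) (hKcomp : IsCompact K) (hKconv : Convex ℝ K)
    (D G : ℝ) (hD : Metric.diam K ≤ D) (hG : 0 < G) :
    ∃ A : List (EuclideanSpace ℝ (Fin d)) → EuclideanSpace ℝ (Fin d),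
      (∀ l, A l ∈ K) ∧
      ∀ (T : ℕ), 1 ≤ T → ∀ f : ℕ → EuclideanSpace ℝ (Fin d),
        (∀ t < T, ‖f t‖ ≤ G) →
        (∑ t ∈ Finset.range T, ⟪f t, A (List.ofFn (fun i : Fin t => f i))⟫)
            - sInf ((fun x => ∑ t ∈ Finset.range T, ⟪f t, x⟫) '' K)
          ≤ (3 / 2) * G * D * Real.sqrt T := by
  obtain ⟨P, hP⟩ := exists_projection_inner_le_zero hKne hKcomp.isComplete hKconv
  obtain ⟨x₀, hx₀⟩ := hKne
  set B := projectedGradientDescent P x₀ (fun t => D / (G * √(t + 1 : ℝ)))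
  have hB : ∀ l, B l ∈ K := by
    rintro (_ | ⟨v, l⟩)
    · exact hx₀
    · exact (hP _).1
  refine ⟨fun l => B l.reverse, fun l => hB _, fun T _ f hf => ?_⟩
  rw [sub_le_comm]
  refine le_csInf (Set.Nonempty.image _ ⟨x₀, hx₀⟩) ?_
  rintro _ ⟨y, hy, rfl⟩
  have key := sum_inner_sub_le_of_gradient_step (f := f) (y := y)
    (x := fun t => B (List.ofFn (fun i : Fin t => f i)).reverse)
    (Metric.diam_nonneg.trans hD) hG hf
    (fun t => by
      rw [← dist_eq_norm]
      exact (Metric.dist_le_diam_of_mem hKcomp.isBounded (hB _) hy).trans hD)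
    (fun t => by
      have e : (List.ofFn (fun i : Fin (t + 1) => f i)).reverse
          = f t :: (List.ofFn (fun i : Fin t => f i)).reverse := by
        rw [List.ofFn_succ', List.concat_eq_append, List.reverse_concat]
        simp
      have e' : B (List.ofFn (fun i : Fin (t + 1) => f i)).reverse
          = P (B (List.ofFn (fun i : Fin t => f i)).reverse
            - (D / (G * √(t + 1 : ℝ))) • f t) := by
        rw [e]
        simp [B, projectedGradientDescent]
      simp only [e']
      exact norm_sub_sq_le_of_inner_le_zero ((hP _).2 y hy))
  simp only [inner_sub_right, Finset.sum_sub_distrib] at key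
  linarith
end

section
/- Let K ⊆ ℝ^n be a nonempty finite decision set, let M : ℝ^n → K be a minimization oracle satisfying ⟨v, M(v)⟩ = min_{x∈K} ⟨v, x⟩ for every v ∈ ℝ^n, and let f^{(1)},…,f^{(T)} ∈ ℝ^n be loss vectors. Let D ≥ max_{x,x'∈K} ‖x − x'‖₁, R ≥ |⟨f^{(t)}, x⟩| for all t and all x ∈ K, and A ≥ ‖f^{(t)}‖₁ for all t, and let ε > 0. Then the expected cost of follow-the-perturbed-leader with perturbations drawn uniformly from the cube [0, 1/ε]^n satisfies Σ_{t=1}^T E_{p∼Unif([0,1/ε]^n)}[⟨f^{(t)}, M(Σ_{τ<t} f^{(τ)} + p)⟩] ≤ min_{x∈K} Σ_{t=1}^T ⟨f^{(t)}, x⟩ + ε R A T + D/ε. In particular, taking ε = 1/√T gives expected regret at most (R A + D)√T = O(√T). -/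
open MeasureTheory

lemma one_sub_sum_le_prod_max_one_sub {ι : Type*} (s : Finset ι) (a : ι → ℝ)
    (ha : ∀ i ∈ s, 0 ≤ a i) : 1 - ∑ i ∈ s, a i ≤ ∏ i ∈ s, max (1 - a i) 0 := by
  classical
  induction s using Finset.induction_on with
  | empty => simp
  | insert j s hj ih =>
    rw [Finset.sum_insert hj, Finset.prod_insert hj]
    have haj : 0 ≤ a j := ha j (Finset.mem_insert_self j s)
    have hs : ∀ i ∈ s, 0 ≤ a i := fun i hi => ha i (Finset.mem_insert_of_mem hi)
    have hP0 : 0 ≤ ∏ i ∈ s, max (1 - a i) 0 := Finset.prod_nonneg fun i _ => le_max_right _ _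
    have hP1 : ∏ i ∈ s, max (1 - a i) 0 ≤ 1 :=
      Finset.prod_le_one (fun i _ => le_max_right _ _) fun i hi =>
        max_le (by linarith [hs i hi]) zero_le_one
    have hmul := mul_le_mul_of_nonneg_right (le_max_left (1 - a j) 0) hP0
    nlinarith [ih hs, mul_nonneg haj (sub_nonneg.2 hP1)]

lemma setIntegral_sub_setIntegral_le_of_abs_le {α : Type*} [MeasurableSpace α] {μ : Measure α}
    {s t : Set α} (hs : MeasurableSet s) (ht : MeasurableSet t) (hμs : μ s ≠ ⊤) (hμt : μ t ≠ ⊤)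
    {g : α → ℝ} (hg : Measurable g) {R : ℝ} (hR : ∀ x, |g x| ≤ R) :
    ∫ x in s, g x ∂μ - ∫ x in t, g x ∂μ ≤ R * (μ.real (s \ t) + μ.real (t \ s)) := by
  have key : ∀ u : Set α, μ u ≠ ⊤ → IntegrableOn g u μ := fun u hu =>
    IntegrableOn.of_bound hu.lt_top hg.aestronglyMeasurable R (Filter.Eventually.of_forall hR)
  have hst := integral_inter_add_sdiff ht (key s hμs)
  have hts := integral_inter_add_sdiff hs (key t hμt)
  rw [Set.inter_comm] at hts
  have h1 := norm_setIntegral_le_of_norm_le_const (μ := μ) (f := g) (s := s \ t) (C := R)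
    (measure_lt_top_of_subset Set.sdiff_subset hμs) fun x _ => hR x
  have h2 := norm_setIntegral_le_of_norm_le_const (μ := μ) (f := g) (s := t \ s) (C := R)
    (measure_lt_top_of_subset Set.sdiff_subset hμt) fun x _ => hR x
  rw [Real.norm_eq_abs] at h1 h2
  linarith [le_abs_self (∫ x in s \ t, g x ∂μ), neg_abs_le (∫ x in t \ s, g x ∂μ)]

section Cube

variable {ι : Type*} [Fintype ι]

lemma volume_real_cube {L : ℝ} (hL : 0 ≤ L) (h : ι → ℝ) :
    volume.real (Set.Icc h (h + fun _ => L)) = L ^ Fintype.card ι := by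
  simp [Measure.real, Real.volume_Icc_pi, ENNReal.toReal_ofReal hL]

lemma volume_real_cube_inter_ge {L : ℝ} (hL : 0 < L) (h : ι → ℝ) :
    L ^ Fintype.card ι * (1 - (∑ i, |h i|) / L) ≤
      volume.real (Set.Icc 0 (fun _ => L) ∩ Set.Icc h (h + fun _ => L)) := by
  have hvol : volume.real (Set.Icc 0 (fun _ => L) ∩ Set.Icc h (h + fun _ => L)) =
      L ^ Fintype.card ι * ∏ i, max (1 - |h i| / L) 0 := by
    rw [Set.Icc_inter_Icc, Measure.real, Real.volume_Icc_pi, ENNReal.toReal_prod,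
      ← Finset.card_univ, ← Finset.prod_const, ← Finset.prod_mul_distrib]
    refine Finset.prod_congr rfl fun i _ => ?_
    have hi : L ⊓ (h i + L) - 0 ⊔ h i = L * (1 - |h i| / L) := by
      rw [mul_sub, mul_div_cancel₀ _ hL.ne']
      rcases le_total 0 (h i) with h0 | h0
      · rw [inf_eq_left.2 (by linarith), sup_eq_right.2 h0, abs_of_nonneg h0]; ring
      · rw [inf_eq_right.2 (by linarith), sup_eq_left.2 h0, abs_of_nonpos h0]; ring
    simp only [Pi.inf_apply, Pi.sup_apply, Pi.add_apply, Pi.zero_apply]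
    rw [hi, ENNReal.toReal_ofReal', mul_max_of_nonneg _ _ hL.le, mul_zero]
  rw [hvol, Finset.sum_div]
  gcongr
  exact one_sub_sum_le_prod_max_one_sub _ _ fun i _ => by positivity

lemma setIntegral_cube_sub_comp_add_le {L : ℝ} (hL : 0 < L) {g : (ι → ℝ) → ℝ}
    (hg : Measurable g) {R : ℝ} (hR : ∀ x, |g x| ≤ R) (h : ι → ℝ) :
    (∫ p in Set.Icc (0 : ι → ℝ) (fun _ => L), g p) -
        ∫ p in Set.Icc (0 : ι → ℝ) (fun _ => L), g (h + p) ≤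
      2 * R * (L ^ Fintype.card ι * ((∑ i, |h i|) / L)) := by
  have hR0 : 0 ≤ R := (abs_nonneg _).trans (hR 0)
  have htrans : ∫ p in Set.Icc (0 : ι → ℝ) (fun _ => L), g (h + p) =
      ∫ p in Set.Icc h (h + fun _ => L), g p := by
    rw [← (measurePreserving_add_left volume h).setIntegral_preimage_emb
      (measurableEmbedding_addLeft h) g (Set.Icc h (h + fun _ => L))]
    simp
  rw [htrans]
  have hfin : ∀ a b : ι → ℝ, volume (Set.Icc a b) ≠ ⊤ := fun a b => isCompact_Icc.measure_ne_top
  refine (setIntegral_sub_setIntegral_le_of_abs_le measurableSet_Icc measurableSet_Icc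
    (hfin _ _) (hfin _ _) hg hR).trans ?_
  have h1 := measureReal_inter_add_sdiff (μ := volume) (s := Set.Icc 0 (fun _ => L))
    (measurableSet_Icc (a := h) (b := h + fun _ => L)) (hfin _ _)
  have h2 := measureReal_inter_add_sdiff (μ := volume) (s := Set.Icc h (h + fun _ => L))
    (measurableSet_Icc (a := (0 : ι → ℝ)) (b := fun _ => L)) (hfin _ _)
  rw [Set.inter_comm, volume_real_cube hL.le] at h2
  have h0 : volume.real (Set.Icc (0 : ι → ℝ) (fun _ => L)) = L ^ Fintype.card ι := by
    simpa using volume_real_cube hL.le (0 : ι → ℝ)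
  have h3 := volume_real_cube_inter_ge hL h
  rw [mul_assoc, mul_left_comm]
  exact mul_le_mul_of_nonneg_left (by linarith) hR0

open Filter in
lemma le_of_forall_sub_mul_one_add_inv_le {a b x : ℝ}
    (h : ∀ N : ℕ, a - b * (1 + 1 / ((N : ℝ) + 1)) ≤ x) : a - b ≤ x := by
  have hlim : Tendsto (fun N : ℕ => a - b * (1 + 1 / ((N : ℝ) + 1))) atTop
      (nhds (a - b * (1 + 0))) :=
    tendsto_const_nhds.sub
      ((tendsto_const_nhds.add tendsto_one_div_add_atTop_nhds_zero_nat).const_mul b)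
  simpa using le_of_tendsto' hlim h

/-- The integral over the cube `[0, L]^ι` of the perturbed optimal value `⟨s + p, M (s + p)⟩`. -/
noncomputable def perturbedValue (M : (ι → ℝ) → (ι → ℝ)) (L : ℝ) (s : ι → ℝ) : ℝ :=
  ∫ p in Set.Icc (0 : ι → ℝ) (fun _ => L), (s + p) ⬝ᵥ M (s + p)

/-- The integral over the cube `[0, L]^ι` of the loss `⟨g, M (s + p)⟩`. -/
noncomputable def perturbedLoss (M : (ι → ℝ) → (ι → ℝ)) (L : ℝ) (g s : ι → ℝ) : ℝ :=
  ∫ p in Set.Icc (0 : ι → ℝ) (fun _ => L), g ⬝ᵥ M (s + p)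

variable {M : (ι → ℝ) → (ι → ℝ)} {L : ℝ}

lemma integrableOn_cube_dotProduct (hM : Measurable M) {C : ℝ} (hC : ∀ v i, |M v i| ≤ C)
    {w : (ι → ℝ) → (ι → ℝ)} (hw : Continuous w) (s : ι → ℝ) :
    IntegrableOn (fun p => w p ⬝ᵥ M (s + p)) (Set.Icc (0 : ι → ℝ) (fun _ => L)) := by
  refine integrable_finsetSum _ fun i _ => ?_
  refine IntegrableOn.continuousOn_mul (g := fun p => w p i) (by fun_prop) ?_ isCompact_Icc
  refine IntegrableOn.of_bound isCompact_Icc.measure_lt_top ?_ C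
    (Filter.Eventually.of_forall fun p => hC _ i)
  exact ((measurable_pi_apply i).comp
    (hM.comp (measurable_const_add s))).aestronglyMeasurable

lemma perturbedLoss_smul (c : ℝ) (g s : ι → ℝ) :
    perturbedLoss M L (c • g) s = c * perturbedLoss M L g s := by
  simp only [perturbedLoss, smul_dotProduct, smul_eq_mul, integral_const_mul]

lemma perturbedValue_add_perturbedLoss_le (hM : Measurable M) {C : ℝ}
    (hC : ∀ v i, |M v i| ≤ C) (hmin : ∀ v w, v ⬝ᵥ M v ≤ v ⬝ᵥ M w) (s g : ι → ℝ) :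
    perturbedValue M L s + perturbedLoss M L g (s + g) ≤ perturbedValue M L (s + g) := by
  have h1 : IntegrableOn (fun p => (s + p) ⬝ᵥ M (s + p)) (Set.Icc (0 : ι → ℝ) (fun _ => L)) :=
    integrableOn_cube_dotProduct hM hC (by fun_prop) s
  have h2 : IntegrableOn (fun p => g ⬝ᵥ M (s + g + p)) (Set.Icc (0 : ι → ℝ) (fun _ => L)) :=
    integrableOn_cube_dotProduct hM hC (by fun_prop) (s + g)
  have h3 : IntegrableOn (fun p => (s + g + p) ⬝ᵥ M (s + g + p))
      (Set.Icc (0 : ι → ℝ) (fun _ => L)) :=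
    integrableOn_cube_dotProduct hM hC (by fun_prop) (s + g)
  rw [perturbedValue, perturbedLoss, perturbedValue, ← integral_add h1 h2]
  refine integral_mono (h1.add h2) h3 fun p => ?_
  have hsplit : (s + g + p) ⬝ᵥ M (s + g + p) =
      (s + p) ⬝ᵥ M (s + g + p) + g ⬝ᵥ M (s + g + p) := by
    rw [← add_dotProduct, add_right_comm]
  simp only [hsplit]
  gcongr
  exact hmin _ _

lemma perturbedLoss_sub_le (hM : Measurable M) (hL : 0 < L) {g : ι → ℝ} {R : ℝ}
    (hR : ∀ v, |g ⬝ᵥ M v| ≤ R) (s h : ι → ℝ) :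
    perturbedLoss M L g s - perturbedLoss M L g (s + h) ≤
      2 * R * (L ^ Fintype.card ι * ((∑ i, |h i|) / L)) := by
  have hmeas : Measurable fun p => g ⬝ᵥ M (s + p) :=
    Finset.measurable_sum _ fun i _ => ((measurable_pi_apply i).comp
      (hM.comp (measurable_const_add s))).const_mul (g i)
  simpa only [perturbedLoss, add_assoc] using
    setIntegral_cube_sub_comp_add_le hL hmeas (fun p => hR (s + p)) h

lemma perturbedValue_add_mul_perturbedLoss_sub_le (hM : Measurable M) (hL : 0 < L) {C : ℝ}
    (hC : ∀ v i, |M v i| ≤ C) (hmin : ∀ v w, v ⬝ᵥ M v ≤ v ⬝ᵥ M w) {f : ι → ℝ} {R : ℝ}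
    (hR : ∀ v, |f ⬝ᵥ M v| ≤ R) (s : ι → ℝ) {c : ℝ} (hc : 0 ≤ c) (k : ℕ) :
    perturbedValue M L s + k * c * perturbedLoss M L f s -
        R * (L ^ Fintype.card ι * ((∑ i, |f i|) / L)) * (c ^ 2 * (k * (k + 1))) ≤
      perturbedValue M L (s + (k * c) • f) := by
  induction k with
  | zero => simp
  | succ k ih =>
    have hstep := perturbedValue_add_perturbedLoss_le (L := L) hM hC hmin (s + (k * c) • f) (c • f)
    have hadd : s + (k * c) • f + c • f = s + (((k + 1 : ℕ) : ℝ) * c) • f := by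
      push_cast; module
    rw [hadd, perturbedLoss_smul] at hstep
    have hshift := perturbedLoss_sub_le hM hL hR s ((((k + 1 : ℕ) : ℝ) * c) • f)
    have hnorm : ∑ i, |((((k + 1 : ℕ) : ℝ) * c) • f) i| = ((k + 1 : ℕ) : ℝ) * c * ∑ i, |f i| := by
      simp only [Pi.smul_apply, smul_eq_mul, abs_mul, Finset.mul_sum, abs_of_nonneg hc,
        Nat.abs_cast]
    rw [hnorm] at hshift
    have hmul := mul_le_mul_of_nonneg_left hshift hc
    push_cast at *
    linear_combination ih + hstep + hmul

lemma perturbedLoss_le (hM : Measurable M) (hL : 0 < L) {C : ℝ}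
    (hC : ∀ v i, |M v i| ≤ C) (hmin : ∀ v w, v ⬝ᵥ M v ≤ v ⬝ᵥ M w) {f : ι → ℝ} {R : ℝ}
    (hR : ∀ v, |f ⬝ᵥ M v| ≤ R) (s : ι → ℝ) :
    perturbedLoss M L f s ≤ perturbedValue M L (s + f) - perturbedValue M L s +
      R * (L ^ Fintype.card ι * ((∑ i, |f i|) / L)) := by
  suffices h : perturbedValue M L s + perturbedLoss M L f s -
      R * (L ^ Fintype.card ι * ((∑ i, |f i|) / L)) ≤ perturbedValue M L (s + f) by linarith
  refine le_of_forall_sub_mul_one_add_inv_le fun N => ?_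
  have hN : (N : ℝ) + 1 ≠ 0 := by positivity
  have h := perturbedValue_add_mul_perturbedLoss_sub_le hM hL hC hmin hR s
    (c := 1 / ((N : ℝ) + 1)) (by positivity) (N + 1)
  push_cast at h
  have hsq : (1 / ((N : ℝ) + 1)) ^ 2 * (((N : ℝ) + 1) * ((N : ℝ) + 1 + 1)) =
      1 + 1 / ((N : ℝ) + 1) := by field_simp
  rwa [hsq, mul_one_div_cancel hN, one_mul, one_smul] at h

lemma sum_perturbedLoss_le (hM : Measurable M) (hL : 0 < L) {C : ℝ}
    (hC : ∀ v i, |M v i| ≤ C) (hmin : ∀ v w, v ⬝ᵥ M v ≤ v ⬝ᵥ M w) {f : ℕ → ι → ℝ} {R A : ℝ}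
    {T : ℕ} (hR : ∀ t < T, ∀ v, |f t ⬝ᵥ M v| ≤ R) (hA : ∀ t < T, ∑ i, |f t i| ≤ A) :
    ∑ t ∈ Finset.range T, perturbedLoss M L (f t) (∑ τ ∈ Finset.range t, f τ) ≤
      perturbedValue M L (∑ τ ∈ Finset.range T, f τ) - perturbedValue M L 0 +
        T * (R * (L ^ Fintype.card ι * (A / L))) := by
  induction T with
  | zero => simp
  | succ T ih =>
    have hprev := ih (fun t ht => hR t (ht.trans T.lt_succ_self))
      fun t ht => hA t (ht.trans T.lt_succ_self)
    have hlast := perturbedLoss_le hM hL hC hmin (hR T T.lt_succ_self)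
      (∑ τ ∈ Finset.range T, f τ)
    have hR0 : 0 ≤ R := (abs_nonneg _).trans (hR T T.lt_succ_self 0)
    have hle : R * (L ^ Fintype.card ι * ((∑ i, |f T i|) / L)) ≤
        R * (L ^ Fintype.card ι * (A / L)) := by
      gcongr
      exact hA T T.lt_succ_self
    rw [Finset.sum_range_succ, Finset.sum_range_succ (fun τ => f τ)]
    push_cast
    linarith

lemma perturbedValue_sub_perturbedValue_zero_le (hM : Measurable M) (hL : 0 < L) {C : ℝ}
    (hC : ∀ v i, |M v i| ≤ C) {x : ι → ℝ} (hmin : ∀ v, v ⬝ᵥ M v ≤ v ⬝ᵥ x) {D : ℝ}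
    (hD : ∀ v, ∑ i, |x i - M v i| ≤ D) (s : ι → ℝ) :
    perturbedValue M L s - perturbedValue M L 0 ≤
      L ^ Fintype.card ι * (s ⬝ᵥ x + L * D) := by
  have hintegrable : ∀ u : ι → ℝ, IntegrableOn (fun p => (u + p) ⬝ᵥ M (u + p))
      (Set.Icc (0 : ι → ℝ) (fun _ => L)) := fun u =>
    integrableOn_cube_dotProduct hM hC (by fun_prop) u
  rw [perturbedValue, perturbedValue, ← integral_sub (hintegrable s) (hintegrable 0)]
  have hvol : volume.real (Set.Icc (0 : ι → ℝ) (fun _ => L)) = L ^ Fintype.card ι := by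
    simpa using volume_real_cube hL.le (0 : ι → ℝ)
  rw [← hvol, ← smul_eq_mul, ← setIntegral_const]
  refine setIntegral_mono_on ((hintegrable s).sub (hintegrable 0))
    (integrableOn_const isCompact_Icc.measure_ne_top) measurableSet_Icc fun p hp => ?_
  have hdev : p ⬝ᵥ (x - M p) ≤ L * D :=
    calc p ⬝ᵥ (x - M p) ≤ ∑ i, L * |x i - M p i| := by
          refine Finset.sum_le_sum fun i _ => ?_
          exact (mul_le_mul_of_nonneg_left (le_abs_self _) (hp.1 i)).trans
            (mul_le_mul_of_nonneg_right (hp.2 i) (abs_nonneg _))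
      _ ≤ L * D := by
          rw [← Finset.mul_sum]
          exact mul_le_mul_of_nonneg_left (hD p) hL.le
  have hopt := hmin (s + p)
  rw [add_dotProduct s p x] at hopt
  rw [dotProduct_sub] at hdev
  simp only [zero_add]
  linarith

end Cube

/-- Kalai–Vempala bound for follow-the-perturbed-leader over a finite decision set
`K ⊆ ℝ^n`: with perturbations uniform on `[0, 1/ε]^n`, the expected total cost is at
most `min_{x∈K} Σ_t ⟨f^{(t)}, x⟩ + εRAT + D/ε`; in particular, with `ε = 1/√T` the
expected regret is at most `(RA + D)√T`. -/
theorem stmt_6 (n : ℕ) (K : Set (Fin n → ℝ)) (hKne : K.Nonempty) (hKfin : K.Finite)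
    (M : (Fin n → ℝ) → (Fin n → ℝ)) (hMmem : ∀ v, M v ∈ K)
    (hMmin : ∀ v, ∀ x ∈ K, ∑ i, v i * M v i ≤ ∑ i, v i * x i)
    (hMmeas : Measurable M)
    (T : ℕ) (hT : 1 ≤ T) (f : ℕ → (Fin n → ℝ))
    (D R A : ℝ)
    (hD : ∀ x ∈ K, ∀ x' ∈ K, ∑ i, |x i - x' i| ≤ D)
    (hR : ∀ t < T, ∀ x ∈ K, |∑ i, f t i * x i| ≤ R)
    (hA : ∀ t < T, ∑ i, |f t i| ≤ A)
    (ε : ℝ) (hε : 0 < ε) :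
    (∑ t ∈ Finset.range T,
        ε ^ n * ∫ p in Set.Icc (0 : Fin n → ℝ) (fun _ => 1 / ε),
          ∑ i, f t i * M ((∑ τ ∈ Finset.range t, f τ) + p) i)
      ≤ sInf ((fun x => ∑ t ∈ Finset.range T, ∑ i, f t i * x i) '' K)
        + ε * R * A * T + D / ε
    ∧ (ε = 1 / Real.sqrt T →
      (∑ t ∈ Finset.range T,
          ε ^ n * ∫ p in Set.Icc (0 : Fin n → ℝ) (fun _ => 1 / ε),
            ∑ i, f t i * M ((∑ τ ∈ Finset.range t, f τ) + p) i)
        ≤ sInf ((fun x => ∑ t ∈ Finset.range T, ∑ i, f t i * x i) '' K)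
          + (R * A + D) * Real.sqrt T) := by
  have hmin : ∀ v w, v ⬝ᵥ M v ≤ v ⬝ᵥ M w := fun v w => hMmin v _ (hMmem w)
  obtain ⟨C, hC⟩ : ∃ C, ∀ v i, |M v i| ≤ C := by
    obtain ⟨C, hC⟩ := hKfin.isBounded.exists_norm_le
    exact ⟨C, fun v i => (norm_le_pi_norm (M v) i).trans (hC _ (hMmem v))⟩
  have hL : 0 < 1 / ε := by positivity
  obtain ⟨x, hxK, hx⟩ := (hKne.image (fun x => ∑ t ∈ Finset.range T, ∑ i, f t i * x i)).csInf_mem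
    (hKfin.image _)
  have hsum := sum_perturbedLoss_le hMmeas hL hC hmin (fun t ht v => hR t ht _ (hMmem v)) hA
  have hval := perturbedValue_sub_perturbedValue_zero_le hMmeas hL hC
    (fun v => hMmin v x hxK) (fun v => hD x hxK _ (hMmem v)) (∑ τ ∈ Finset.range T, f τ)
  have hbest : (∑ τ ∈ Finset.range T, f τ) ⬝ᵥ x =
      sInf ((fun x => ∑ t ∈ Finset.range T, ∑ i, f t i * x i) '' K) := by
    rw [← hx, sum_dotProduct]
    rfl
  rw [hbest, Fintype.card_fin] at hval
  rw [Fintype.card_fin] at hsum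
  have hone : ε ^ n * (1 / ε) ^ n = 1 := by
    rw [← mul_pow, mul_one_div_cancel hε.ne', one_pow]
  have hmain : (∑ t ∈ Finset.range T,
        ε ^ n * ∫ p in Set.Icc (0 : Fin n → ℝ) (fun _ => 1 / ε),
          ∑ i, f t i * M ((∑ τ ∈ Finset.range t, f τ) + p) i)
      ≤ sInf ((fun x => ∑ t ∈ Finset.range T, ∑ i, f t i * x i) '' K)
        + ε * R * A * T + D / ε := by
    rw [← Finset.mul_sum]
    refine (mul_le_mul_of_nonneg_left (hsum.trans (add_le_add_left hval _))
      (pow_nonneg hε.le n)).trans_eq ?_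
    have hdiv : A / (1 / ε) = ε * A := by field_simp
    rw [hdiv]
    linear_combination (sInf ((fun x => ∑ t ∈ Finset.range T, ∑ i, f t i * x i) '' K)
      + 1 / ε * D + T * R * (ε * A)) * hone
  refine ⟨hmain, fun hεT => hmain.trans_eq ?_⟩
  have hT0 : 0 < Real.sqrt T := Real.sqrt_pos.2 (by exact_mod_cast hT)
  have hsq : Real.sqrt T * Real.sqrt T = T := Real.mul_self_sqrt T.cast_nonneg
  have h1 : ε * T = Real.sqrt T := by
    rw [hεT, one_div, inv_mul_eq_iff_eq_mul₀ hT0.ne', hsq]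
  have h2 : D / ε = D * Real.sqrt T := by
    rw [hεT, div_div_eq_mul_div, div_one]
  rw [h2]
  linear_combination R * A * h1
end

section
/- In an opinion formation game with w_ii > 0 and w_ij ≥ 0 for all i and all j ≠ i, for every internal opinion vector s ∈ ℝ^n there exists a unique vector z ∈ ℝ^n satisfying z_i = (w_ii s_i + Σ_{j≠i} w_ij z_j)/(w_ii + Σ_{j≠i} w_ij) for every i; equivalently, the game has a unique pure Nash equilibrium. -/
/-- The matrix of the linear system satisfied by the equilibria of an opinion formation game. -/
def opinionMatrix {n : ℕ} (w : Fin n → Fin n → ℝ) : Matrix (Fin n) (Fin n) ℝ :=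
  Matrix.of fun i j =>
    if j = i then w i i + ∑ k ∈ Finset.univ.erase i, w i k else -w i j

theorem opinionMatrix_mulVec {n : ℕ} (w : Fin n → Fin n → ℝ) (z : Fin n → ℝ) (i : Fin n) :
    (opinionMatrix w).mulVec z i =
      (w i i + ∑ k ∈ Finset.univ.erase i, w i k) * z i
        - ∑ j ∈ Finset.univ.erase i, w i j * z j := by
  have h : ∑ j ∈ Finset.univ.erase i, opinionMatrix w i j * z j =
      -∑ j ∈ Finset.univ.erase i, w i j * z j := by
    rw [← Finset.sum_neg_distrib]
    refine Finset.sum_congr rfl fun j hj => ?_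
    simp [opinionMatrix, Finset.ne_of_mem_erase hj]
  rw [Matrix.mulVec, dotProduct, ← Finset.add_sum_erase _ _ (Finset.mem_univ i), h]
  simp [opinionMatrix, sub_eq_add_neg]

/-- The opinion matrix is strictly diagonally dominant, hence nonsingular. -/
theorem det_opinionMatrix_ne_zero {n : ℕ} {w : Fin n → Fin n → ℝ}
    (hwii : ∀ i, 0 < w i i) (hw : ∀ i j, j ≠ i → 0 ≤ w i j) :
    (opinionMatrix w).det ≠ 0 := by
  refine det_ne_zero_of_sum_row_lt_diag fun i => ?_
  have h : ∑ j ∈ Finset.univ.erase i, ‖opinionMatrix w i j‖ =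
      ∑ j ∈ Finset.univ.erase i, w i j := by
    refine Finset.sum_congr rfl fun j hj => ?_
    have hj' := Finset.ne_of_mem_erase hj
    simp [opinionMatrix, hj', abs_of_nonneg (hw i j hj')]
  have hd : opinionMatrix w i i = w i i + ∑ k ∈ Finset.univ.erase i, w i k := by
    simp [opinionMatrix]
  rw [h, hd]
  exact (lt_add_of_pos_left _ (hwii i)).trans_le (Real.le_norm_self _)

/-- In an opinion formation game with `wᵢᵢ > 0` and `wᵢⱼ ≥ 0`, for every internal
opinion vector `s` there is a unique vector `z` satisfying the update rule
`zᵢ = (wᵢᵢ sᵢ + Σ_{j≠i} wᵢⱼ zⱼ)/(wᵢᵢ + Σ_{j≠i} wᵢⱼ)` for all `i`, i.e. the game has a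
unique pure Nash equilibrium. -/
theorem stmt_9 (n : ℕ) (w : Fin n → Fin n → ℝ)
    (hwii : ∀ i, 0 < w i i) (hw : ∀ i j, j ≠ i → 0 ≤ w i j)
    (s : Fin n → ℝ) :
    ∃! z : Fin n → ℝ, ∀ i : Fin n,
      z i = (w i i * s i + ∑ j ∈ Finset.univ.erase i, w i j * z j)
        / (w i i + ∑ j ∈ Finset.univ.erase i, w i j) := by
  have hz (z : Fin n → ℝ) : (∀ i, z i = (w i i * s i + ∑ j ∈ Finset.univ.erase i, w i j * z j)
      / (w i i + ∑ j ∈ Finset.univ.erase i, w i j)) ↔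
      (opinionMatrix w).mulVec z = fun i => w i i * s i := by
    rw [funext_iff]
    refine forall_congr' fun i => ?_
    have hpos : 0 < w i i + ∑ j ∈ Finset.univ.erase i, w i j :=
      add_pos_of_pos_of_nonneg (hwii i)
        (Finset.sum_nonneg fun j hj => hw i j (Finset.ne_of_mem_erase hj))
    rw [opinionMatrix_mulVec, eq_div_iff hpos.ne', sub_eq_iff_eq_add, mul_comm]
  simp_rw [hz]
  have hu : IsUnit (opinionMatrix w) :=
    (Matrix.isUnit_iff_isUnit_det _).2 (det_opinionMatrix_ne_zero hwii hw).isUnit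
  exact Function.Bijective.existsUnique
    ⟨Matrix.mulVec_injective_iff_isUnit.2 hu, Matrix.mulVec_surjective_iff_isUnit.2 hu⟩ _
end
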